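/- Let A be a commutative ring and B a commutative A-algebra that is finitely generated and projective as an A-module. Equip the A-linear dual Hom_A(B,A) with the B-module structure (b·φ)(x) = φ(bx). Let L be an invertible B-module, i.e. there exist a B-module M and a B-module isomorphism L ⊗_B M ≅ B, and let ρ : L ⊗_B L → Hom_A(B,A) be an isomorphism of B-modules. Then the A-bilinear form q on L (regarded as an A-module by restriction of scalars), defined by q(ℓ,ℓ') = ρ(ℓ ⊗ ℓ')(1), is symmetric, and the induced A-linear map L → Hom_A(L,A), ℓ ↦ q(ℓ,–), is bijective. (This is the affine-local form of the statement that the degree form deg f of a relatively oriented finite, flat, local complete intersection morphism is a symmetric, non-degenerate bilinear form.) -/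

import Mathlib

open TensorProduct

namespace Module.Invertible

variable {R M N : Type*} [CommRing R] [AddCommGroup M] [Module R M] [AddCommGroup N] [Module R N]

/-- An element of an invertible module is zero if all its pure tensors with the module vanish. -/
theorem eq_zero_of_forall_tmul_eq_zero (e : M ⊗[R] N ≃ₗ[R] R) {x : M}
    (h : ∀ y : M, x ⊗ₜ[R] y = 0) : x = 0 := by
  have hz (z : M ⊗[R] N) : e z • x = 0 := by
    induction z with
    | zero => simp
    | add z w hz hw => rw [map_add, add_smul, hz, hw, add_zero]
    | tmul y n =>
      have hxy : (rightCancelEquiv M e) ((x ⊗ₜ[R] y) ⊗ₜ[R] n) = e (y ⊗ₜ n) • x := by simp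
      rw [← hxy, h, zero_tmul, map_zero]
  simpa using hz (e.symm 1)

/-- Every linear map `M → M ⊗ M` out of an invertible module is of the form `y ↦ x ⊗ y`. -/
theorem exists_forall_eq_tmul (e : M ⊗[R] N ≃ₗ[R] R) (g : M →ₗ[R] M ⊗[R] M) :
    ∃ x : M, ∀ y : M, g y = x ⊗ₜ[R] y := by
  obtain ⟨f, hf⟩ := (rTensorEquiv R M e).surjective
    (g ∘ₗ (TensorProduct.lid R M).toLinearMap)
  refine ⟨f 1, fun y ↦ ?_⟩
  exact (congrArg g (one_smul R y).symm).trans (LinearMap.congr_fun hf (1 ⊗ₜ[R] y)).symm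

end Module.Invertible

/-- Let `B` be a commutative `A`-algebra which is finitely generated and
projective as an `A`-module, let `L` be an invertible `B`-module (witnessed by a `B`-module
`M` with `L ⊗[B] M ≃ B`), and let `ρ : L ⊗[B] L ≃ Hom_A(B, A)` be a `B`-module isomorphism,
where `Hom_A(B, A)` carries the `B`-module structure `(b • φ)(x) = φ(b * x)` (this
`B`-semilinearity of the `A`-linear equivalence `ρ` is the hypothesis `hρ`). Then the
`A`-bilinear form `q(ℓ, ℓ') = ρ(ℓ ⊗ ℓ')(1)` on `L` is symmetric, and the induced map
`L → Hom_A(L, A)`, `ℓ ↦ q(ℓ, –)`, is bijective (injective and surjective). -/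
theorem degree_form_symmetric_nondegenerate
    {A B : Type*} [CommRing A] [CommRing B] [Algebra A B]
    [Module.Finite A B] [Module.Projective A B]
    {L : Type*} [AddCommGroup L] [Module A L] [Module B L] [IsScalarTower A B L]
    {M : Type*} [AddCommGroup M] [Module B M]
    (e : (L ⊗[B] M) ≃ₗ[B] B)
    (ρ : (L ⊗[B] L) ≃ₗ[A] (B →ₗ[A] A))
    (hρ : ∀ (b : B) (z : L ⊗[B] L) (x : B), ρ (b • z) x = ρ z (b * x)) :
    (∀ ℓ ℓ' : L, ρ (ℓ ⊗ₜ[B] ℓ') 1 = ρ (ℓ' ⊗ₜ[B] ℓ) 1) ∧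
    (∀ ℓ : L, (∀ ℓ' : L, ρ (ℓ ⊗ₜ[B] ℓ') 1 = 0) → ℓ = 0) ∧
    (∀ φ : L →ₗ[A] A, ∃ ℓ : L, ∀ ℓ' : L, ρ (ℓ ⊗ₜ[B] ℓ') 1 = φ ℓ') := by
  have : Module.Invertible B L := .left e
  have hρ_right (b : B) (ℓ ℓ' : L) : ρ (ℓ ⊗ₜ[B] ℓ') b = ρ (ℓ ⊗ₜ[B] (b • ℓ')) 1 := by
    rw [tmul_smul, hρ, mul_one]
  refine ⟨fun ℓ ℓ' ↦ by rw [Module.Invertible.tmul_comm], fun ℓ h ↦ ?_, fun φ ↦ ?_⟩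
  · refine Module.Invertible.eq_zero_of_forall_tmul_eq_zero e fun ℓ' ↦ ρ.injective ?_
    ext b
    rw [hρ_right, h, map_zero, LinearMap.zero_apply]
  · let ψ (ℓ' : L) : B →ₗ[A] A := φ ∘ₗ (LinearMap.toSpanSingleton B L ℓ').restrictScalars A
    have hψ (ℓ' : L) (b : B) : ψ ℓ' b = φ (b • ℓ') := rfl
    let g : L →ₗ[B] L ⊗[B] L :=
      { toFun ℓ' := ρ.symm (ψ ℓ')
        map_add' x y := by
          rw [← map_add]
          congr 1
          ext b
          simp [hψ]
        map_smul' b x := by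
          apply ρ.injective
          ext c
          simp [hρ, hψ, smul_smul, mul_comm] }
    obtain ⟨ℓ, hℓ⟩ := Module.Invertible.exists_forall_eq_tmul e g
    refine ⟨ℓ, fun ℓ' ↦ ?_⟩
    rw [← hℓ]
    simp [g, hψ]
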